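/- Let Γ be a non-elementary discrete purely hyperbolic subgroup of SL(2,ℝ), and let Φ and Θ be nontrivial convex cocompact subgroups of Γ with Θ non-elementary. Then Λ(Φ) ∩ Λ(Θ) = Λ(Φ ∩ Θ). -/

import Mathlib

open scoped MatrixGroups LinearAlgebra.Projectivization UpperHalfPlane Pointwise
open Matrix

noncomputable section

/-- The topology on `SL(2, ℝ)` as a subspace of the space of `2 × 2` real matrices. -/
instance : TopologicalSpace SL(2, ℝ) :=
  inferInstanceAs (TopologicalSpace { A : Matrix (Fin 2) (Fin 2) ℝ // A.det = 1 })

/-- The real projective line. -/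
abbrev RP1 : Type := ℙ ℝ (Fin 2 → ℝ)

instance : TopologicalSpace RP1 :=
  inferInstanceAs (TopologicalSpace (Quotient (projectivizationSetoid ℝ (Fin 2 → ℝ))))

/-- The action of `SL(2, ℝ)` on the real projective line, via its linear action on `ℝ²`. -/
def sl2Act (g : SL(2, ℝ)) (p : RP1) : RP1 :=
  Projectivization.map (Matrix.SpecialLinearGroup.toLin' g).toLinearMap
    (Matrix.SpecialLinearGroup.toLin' g).injective p

/-- The point `[x : 1]` of the real projective line. -/
def projPt (x : ℝ) : RP1 :=
  Projectivization.mk ℝ ![x, 1] (by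
    intro h
    have := congrFun h 1
    simp at this)

/-- The point `∞ = [1 : 0]` of the real projective line. -/
def projInf : RP1 :=
  Projectivization.mk ℝ ![1, 0] (by
    intro h
    have := congrFun h 0
    simp at this)

/-- The ray in the upper half-plane associated to a point of `ℝP¹`:
`ray [x:1] = {x + i t : 0 < t ≤ 1}` and `ray ∞ = {i t : t ≥ 1}`. -/
def ray (p : RP1) : Set ℍ :=
  if p.rep 1 = 0 then {z : ℍ | z.re = 0 ∧ 1 ≤ z.im}
  else {z : ℍ | z.re = p.rep 0 / p.rep 1 ∧ z.im ≤ 1}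

/-- An element of `SL(2, ℝ)` is hyperbolic if the absolute value of its trace exceeds `2`. -/
def IsHyperbolic (g : SL(2, ℝ)) : Prop :=
  2 < |Matrix.trace (g : Matrix (Fin 2) (Fin 2) ℝ)|

/-- A subgroup of `SL(2, ℝ)` is purely hyperbolic if all of its non-identity elements
are hyperbolic. -/
def PurelyHyperbolic (Γ : Subgroup SL(2, ℝ)) : Prop :=
  ∀ g ∈ Γ, g ≠ 1 → IsHyperbolic g

/-- A subgroup of `SL(2, ℝ)` is non-elementary if it is not virtually abelian, i.e. it has
no abelian subgroup of finite index. -/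
def IsNonElementary (Γ : Subgroup SL(2, ℝ)) : Prop :=
  ¬ ∃ H : Subgroup Γ, H.FiniteIndex ∧ ∀ a ∈ H, ∀ b ∈ H, a * b = b * a

/-- `p ∈ ℝP¹` is a conical limit point of `Γ'` if some compact subset of `ℍ` has infinitely
many `Γ'`-translates meeting the ray ending at `p`. -/
def IsConicalLimitPoint (Γ' : Subgroup SL(2, ℝ)) (p : RP1) : Prop :=
  ∃ K : Set ℍ, IsCompact K ∧ ∃ γ : ℕ → SL(2, ℝ), Function.Injective γ ∧
    (∀ k, γ k ∈ Γ') ∧ ∀ k, (γ k • K ∩ ray p).Nonempty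

/-- `p ∈ ℝP¹` is a uniform conical limit point of `Γ'` if the ray ending at `p` is covered by
the translates of a single compact subset of `ℍ` by an injective sequence in `Γ'`. -/
def IsUniformConicalLimitPoint (Γ' : Subgroup SL(2, ℝ)) (p : RP1) : Prop :=
  ∃ K : Set ℍ, IsCompact K ∧ ∃ γ : ℕ → SL(2, ℝ), Function.Injective γ ∧
    (∀ k, γ k ∈ Γ') ∧ ray p ⊆ ⋃ k, γ k • K

/-- The limit set of a subgroup of `SL(2, ℝ)`: the closure in `ℝP¹` of the set of fixed
points of hyperbolic elements of the subgroup. -/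
def limitSet (Γ' : Subgroup SL(2, ℝ)) : Set RP1 :=
  closure {p : RP1 | ∃ g ∈ Γ', IsHyperbolic g ∧ sl2Act g p = p}


/-- A subgroup of `SL(2, ℝ)` is convex cocompact if its limit set consists exactly of its
conical limit points. -/
def ConvexCocompact (Γ' : Subgroup SL(2, ℝ)) : Prop :=
  limitSet Γ' = {p : RP1 | IsConicalLimitPoint Γ' p}

/-- The squared Euclidean norm of a vector of the plane. -/
def sqNorm (v : Fin 2 → ℝ) : ℝ := v 0 ^ 2 + v 1 ^ 2

/-- The determinant of a pair of vectors of the plane. -/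
def cross (v w : Fin 2 → ℝ) : ℝ := v 0 * w 1 - v 1 * w 0

/-- The squared Hilbert–Schmidt norm of `g` composed with the matrix of columns
`√s • v` and `√s⁻¹ • w`. When `cross v w = ± 1` this is `2 cosh (dist I (g • z))`, for the point
`z` with parameter `log s` on the geodesic of `ℍ` from `[w]` to `[v]`. -/
def energy (v w : Fin 2 → ℝ) (s : ℝ) (g : SL(2, ℝ)) : ℝ :=
  s * sqNorm (g.1 *ᵥ v) + s⁻¹ * sqNorm (g.1 *ᵥ w)

theorem sqNorm_nonneg (v : Fin 2 → ℝ) : 0 ≤ sqNorm v := by unfold sqNorm; positivity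

theorem sqNorm_pos {v : Fin 2 → ℝ} (hv : v ≠ 0) : 0 < sqNorm v := by
  refine (sqNorm_nonneg v).lt_of_ne' fun h ↦ hv ?_
  unfold sqNorm at h
  ext i
  fin_cases i
  · simpa using (by nlinarith [sq_nonneg (v 0), sq_nonneg (v 1)] : v 0 ^ 2 = 0)
  · simpa using (by nlinarith [sq_nonneg (v 0), sq_nonneg (v 1)] : v 1 ^ 2 = 0)

theorem sqNorm_smul (c : ℝ) (v : Fin 2 → ℝ) : sqNorm (c • v) = c ^ 2 * sqNorm v := by
  simp [sqNorm]; ring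

theorem continuous_sqNorm : Continuous sqNorm := by unfold sqNorm; fun_prop

theorem sqNorm_add_le (v w : Fin 2 → ℝ) : sqNorm (v + w) ≤ 2 * sqNorm v + 2 * sqNorm w := by
  simp only [sqNorm, Pi.add_apply]
  nlinarith [sq_nonneg (v 0 - w 0), sq_nonneg (v 1 - w 1)]

theorem cross_sq_le (v w : Fin 2 → ℝ) : cross v w ^ 2 ≤ sqNorm v * sqNorm w := by
  simp only [sqNorm, cross]
  nlinarith [sq_nonneg (v 0 * w 0 + v 1 * w 1)]

theorem cross_smul_smul (a b : ℝ) (v w : Fin 2 → ℝ) :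
    cross (a • v) (b • w) = a * b * cross v w := by
  simp [cross]; ring

theorem mulVec_zero_apply (g : SL(2, ℝ)) (v : Fin 2 → ℝ) :
    (g.1 *ᵥ v) 0 = g.1 0 0 * v 0 + g.1 0 1 * v 1 := by
  simp [Matrix.mulVec, dotProduct, Fin.sum_univ_two]

theorem mulVec_one_apply (g : SL(2, ℝ)) (v : Fin 2 → ℝ) :
    (g.1 *ᵥ v) 1 = g.1 1 0 * v 0 + g.1 1 1 * v 1 := by
  simp [Matrix.mulVec, dotProduct, Fin.sum_univ_two]

theorem cross_mulVec (g : SL(2, ℝ)) (v w : Fin 2 → ℝ) :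
    cross (g.1 *ᵥ v) (g.1 *ᵥ w) = cross v w := by
  have h := g.2
  rw [Matrix.det_fin_two] at h
  simp only [cross, mulVec_zero_apply, mulVec_one_apply]
  linear_combination (v 0 * w 1 - v 1 * w 0) * h

/-- Expansion of a vector in a basis of the plane. -/
theorem cross_smul_eq (v w e : Fin 2 → ℝ) :
    cross v w • e = cross e w • v + cross v e • w := by
  ext i
  fin_cases i <;> simp [cross] <;> ring

theorem eq_smul_add_smul {v w : Fin 2 → ℝ} (h : cross v w ≠ 0) (e : Fin 2 → ℝ) :
    e = (cross e w / cross v w) • v + (cross v e / cross v w) • w := by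
  have := congrArg ((cross v w)⁻¹ • ·) (cross_smul_eq v w e)
  simpa [smul_smul, h, div_eq_inv_mul] using this

theorem mulVec_ne_zero (g : SL(2, ℝ)) {v : Fin 2 → ℝ} (hv : v ≠ 0) : g.1 *ᵥ v ≠ 0 := by
  intro h
  apply hv
  have : (g⁻¹ * g).1 *ᵥ v = 0 := by
    rw [Matrix.SpecialLinearGroup.coe_mul, ← Matrix.mulVec_mulVec, h, Matrix.mulVec_zero]
  simpa using this

theorem mul_mulVec (g h : SL(2, ℝ)) (v : Fin 2 → ℝ) :
    (g * h).1 *ᵥ v = g.1 *ᵥ (h.1 *ᵥ v) := by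
  rw [Matrix.SpecialLinearGroup.coe_mul, Matrix.mulVec_mulVec]

/-- The squared Hilbert–Schmidt norm of a matrix. -/
def hsNorm (g : SL(2, ℝ)) : ℝ := g.1 0 0 ^ 2 + g.1 0 1 ^ 2 + g.1 1 0 ^ 2 + g.1 1 1 ^ 2

theorem hsNorm_nonneg (g : SL(2, ℝ)) : 0 ≤ hsNorm g := by unfold hsNorm; positivity

theorem sqNorm_mulVec_le (g : SL(2, ℝ)) (v : Fin 2 → ℝ) :
    sqNorm (g.1 *ᵥ v) ≤ hsNorm g * sqNorm v := by
  simp only [sqNorm, hsNorm, mulVec_zero_apply, mulVec_one_apply]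
  nlinarith [sq_nonneg (g.1 0 0 * v 1 - g.1 0 1 * v 0), sq_nonneg (g.1 1 0 * v 1 - g.1 1 1 * v 0)]

theorem energy_nonneg (v w : Fin 2 → ℝ) {s : ℝ} (hs : 0 < s) (g : SL(2, ℝ)) :
    0 ≤ energy v w s g := by
  have := sqNorm_nonneg (g.1 *ᵥ v)
  have := sqNorm_nonneg (g.1 *ᵥ w)
  unfold energy; positivity

theorem energy_mul_le (v w : Fin 2 → ℝ) {s : ℝ} (hs : 0 < s) (g h : SL(2, ℝ)) :
    energy v w s (g * h) ≤ hsNorm g * energy v w s h := by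
  have h1 := mul_le_mul_of_nonneg_left (sqNorm_mulVec_le g (h.1 *ᵥ v)) hs.le
  have h2 := mul_le_mul_of_nonneg_left (sqNorm_mulVec_le g (h.1 *ᵥ w)) (inv_pos.2 hs).le
  simp only [energy, mul_mulVec]
  linarith

theorem sq_sub_le_weighted {s : ℝ} (hs : 0 < s) (a b x y : ℝ) :
    (a * y - b * x) ^ 2 ≤ (s * a ^ 2 + s⁻¹ * b ^ 2) * (s * x ^ 2 + s⁻¹ * y ^ 2) := by
  have h : s * s⁻¹ = 1 := mul_inv_cancel₀ hs.ne'
  have : (s * a ^ 2 + s⁻¹ * b ^ 2) * (s * x ^ 2 + s⁻¹ * y ^ 2) - (a * y - b * x) ^ 2 =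
      (s * (a * x) + s⁻¹ * (b * y)) ^ 2 := by
    linear_combination (a ^ 2 * y ^ 2 + b ^ 2 * x ^ 2 - 2 * a * b * x * y) * h
  nlinarith [sq_nonneg (s * (a * x) + s⁻¹ * (b * y))]

/-- The squared Hilbert–Schmidt norm of a quotient is controlled by the energies. -/
theorem cross_sq_mul_hsNorm_le (v w : Fin 2 → ℝ) {s : ℝ} (hs : 0 < s) (g h : SL(2, ℝ)) :
    cross v w ^ 2 * hsNorm (g * h⁻¹) ≤ energy v w s g * energy v w s h := by
  obtain ⟨k, rfl⟩ : ∃ k, g = k * h := ⟨g * h⁻¹, by group⟩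
  rw [mul_inv_cancel_right, ← cross_mulVec h v w]
  simp only [energy, mul_mulVec]
  generalize h.1 *ᵥ v = x
  generalize h.1 *ᵥ w = y
  have key (i j : Fin 2) := sq_sub_le_weighted hs ((k.1 *ᵥ x) i) ((k.1 *ᵥ y) i) (x j) (y j)
  have h00 := key 0 0
  have h01 := key 0 1
  have h10 := key 1 0
  have h11 := key 1 1
  have e : cross x y ^ 2 * hsNorm k =
      ((k.1 *ᵥ x) 0 * y 0 - (k.1 *ᵥ y) 0 * x 0) ^ 2 +
      ((k.1 *ᵥ x) 0 * y 1 - (k.1 *ᵥ y) 0 * x 1) ^ 2 +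
      ((k.1 *ᵥ x) 1 * y 0 - (k.1 *ᵥ y) 1 * x 0) ^ 2 +
      ((k.1 *ᵥ x) 1 * y 1 - (k.1 *ᵥ y) 1 * x 1) ^ 2 := by
    simp only [mulVec_zero_apply, mulVec_one_apply, cross, hsNorm]
    ring
  rw [e]
  simp only [sqNorm]
  linarith

theorem hsNorm_le_of_sqNorm_le (v w : Fin 2 → ℝ) (g : SL(2, ℝ)) :
    cross v w ^ 2 * hsNorm g ≤
      (sqNorm (g.1 *ᵥ v) + sqNorm (g.1 *ᵥ w)) * (sqNorm v + sqNorm w) := by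
  simpa [energy] using cross_sq_mul_hsNorm_le v w one_pos g 1

theorem finite_hsNorm_le {Γ : Subgroup SL(2, ℝ)} (hΓ : DiscreteTopology Γ) (C : ℝ) :
    {g | g ∈ Γ ∧ hsNorm g ≤ C}.Finite := by
  have hclosed : IsClosed (Γ : Set SL(2, ℝ)) :=
    @Subgroup.isClosed_of_discrete SL(2, ℝ) _ Matrix.SpecialLinearGroup.instTopologicalSpace
      Matrix.SpecialLinearGroup.topologicalGroup
      (Matrix.SpecialLinearGroup.isClosedEmbedding_val.isEmbedding.t2Space) Γ hΓ
  have hemb : Topology.IsClosedEmbedding ((↑) : SL(2, ℝ) → Matrix (Fin 2) (Fin 2) ℝ) :=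
    Matrix.SpecialLinearGroup.isClosedEmbedding_val
  have hK : IsCompact (Set.pi Set.univ fun _ : Fin 2 ↦ Set.pi Set.univ fun _ : Fin 2 ↦
      Set.Icc (-(1 + C)) (1 + C)) :=
    isCompact_univ_pi fun _ ↦ isCompact_univ_pi fun _ ↦ isCompact_Icc
  have hfin : ((Γ : Set SL(2, ℝ)) ∩ (fun g : SL(2, ℝ) ↦ g.1) ⁻¹'
      (Set.pi Set.univ fun _ : Fin 2 ↦ Set.pi Set.univ fun _ : Fin 2 ↦
      Set.Icc (-(1 + C)) (1 + C))).Finite := by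
    refine IsCompact.finite ((hemb.isCompact_preimage hK).inter_left hclosed) ?_
    exact (isDiscrete_iff_discreteTopology.2 hΓ).mono Set.inter_subset_left
  refine hfin.subset fun g hg ↦ ⟨hg.1, ?_⟩
  have h := hg.2
  unfold hsNorm at h
  suffices ∀ i j, g.1 i j ∈ Set.Icc (-(1 + C)) (1 + C) from fun i _ j _ ↦ this i j
  intro i j
  have : g.1 i j ^ 2 ≤ C := by
    fin_cases i <;> fin_cases j <;> simp only [Fin.zero_eta, Fin.mk_one] <;>
    nlinarith [sq_nonneg (g.1 0 0), sq_nonneg (g.1 0 1), sq_nonneg (g.1 1 0), sq_nonneg (g.1 1 1)]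
  constructor <;> nlinarith [sq_nonneg (g.1 i j - 1), sq_nonneg (g.1 i j + 1)]
theorem IsHyperbolic.exists_eigenvectors {g : SL(2, ℝ)} (hg : _root_.IsHyperbolic g) :
    ∃ e f : Fin 2 → ℝ, ∃ a b : ℝ, cross e f ≠ 0 ∧ g.1 *ᵥ e = a • e ∧ g.1 *ᵥ f = b • f := by
  have hdet := g.2
  rw [Matrix.det_fin_two] at hdet
  unfold _root_.IsHyperbolic at hg
  rw [Matrix.trace_fin_two] at hg
  set a := g.1 0 0 with ha
  set b := g.1 0 1 with hb
  set c := g.1 1 0 with hc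
  set d := g.1 1 1 with hd
  have htr : 4 < (a + d) ^ 2 := by
    have := sq_abs (a + d)
    nlinarith [abs_nonneg (a + d)]
  by_cases hb0 : b = 0
  · have had : a - d ≠ 0 := by
      intro h
      rw [hb0, sub_eq_zero.1 h] at hdet
      rw [sub_eq_zero.1 h] at htr
      nlinarith
    refine ⟨![a - d, c], ![0, 1], a, d, by simpa [cross] using had, ?_, ?_⟩
    · ext i
      fin_cases i
      · simp [mulVec_zero_apply, ← ha, ← hb, hb0]
      · simp [mulVec_one_apply, ← hc, ← hd]; ring
    · ext i
      fin_cases i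
      · simp [mulVec_zero_apply, ← hb, hb0]
      · simp [mulVec_one_apply, ← hd]
  · set r := √((a + d) ^ 2 - 4) with hr
    have hr2 : r ^ 2 = (a + d) ^ 2 - 4 := Real.sq_sqrt (by linarith)
    have hr0 : 0 < r := Real.sqrt_pos.2 (by linarith)
    have eig (t : ℝ) (ht : t ^ 2 = (a + d) ^ 2 - 4) :
        g.1 *ᵥ ![b, (a + d + t) / 2 - a] = ((a + d + t) / 2) • ![b, (a + d + t) / 2 - a] := by
      ext i
      fin_cases i
      · simp [mulVec_zero_apply, ← ha, ← hb]; ring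
      · simp [mulVec_one_apply, ← hc, ← hd]
        linear_combination -hdet - ht / 4
    refine ⟨_, _, _, _, ?_, eig r hr2, eig (-r) (by rw [neg_sq, hr2])⟩
    have : cross ![b, (a + d + r) / 2 - a] ![b, (a + d + -r) / 2 - a] = -(b * r) := by
      simp [cross]; ring
    rw [this]
    exact neg_ne_zero.2 (mul_ne_zero hb0 hr0.ne')

theorem ne_zero_of_cross_ne_zero_left {v w : Fin 2 → ℝ} (h : cross v w ≠ 0) : v ≠ 0 := by
  rintro rfl; simp [cross] at h

theorem ne_zero_of_cross_ne_zero_right {v w : Fin 2 → ℝ} (h : cross v w ≠ 0) : w ≠ 0 := by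
  rintro rfl; simp [cross] at h

theorem sl2Act_mk (g : SL(2, ℝ)) {v : Fin 2 → ℝ} (hv : v ≠ 0) :
    sl2Act g (Projectivization.mk ℝ v hv) =
      Projectivization.mk ℝ (g.1 *ᵥ v) (mulVec_ne_zero g hv) := rfl

theorem mk_smul_eq {v : Fin 2 → ℝ} (hv : v ≠ 0) {c : ℝ} (hcv : c • v ≠ 0) :
    Projectivization.mk ℝ (c • v) hcv = Projectivization.mk ℝ v hv :=
  (Projectivization.mk_eq_mk_iff' ℝ _ _ hcv hv).2 ⟨c, rfl⟩

theorem sl2Act_mul (g h : SL(2, ℝ)) (p : RP1) : sl2Act (g * h) p = sl2Act g (sl2Act h p) := by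
  induction p using Projectivization.ind with
  | h v hv =>
    simp only [sl2Act_mk]
    congr 1
    exact mul_mulVec g h v

theorem continuous_projectivization_mk :
    Continuous fun v : {v : Fin 2 → ℝ // v ≠ 0} ↦ (Projectivization.mk ℝ v.1 v.2 : RP1) :=
  continuous_quotient_mk'

theorem continuous_sl2Act (g : SL(2, ℝ)) : Continuous (sl2Act g) := by
  have h : Continuous fun v : {v : Fin 2 → ℝ // v ≠ 0} ↦
      (⟨g.1 *ᵥ v.1, mulVec_ne_zero g v.2⟩ : {v : Fin 2 → ℝ // v ≠ 0}) := by
    fun_prop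
  exact continuous_quot_lift _ (continuous_projectivization_mk.comp h)

/-- A limit of nonzero vectors whose lines lie in a closed set spans a line in this set. -/
theorem IsClosed.mk_mem_of_tendsto {S : Set RP1} (hS : IsClosed S) {u : ℕ → Fin 2 → ℝ}
    {v : Fin 2 → ℝ} (hv : v ≠ 0) (hu : ∀ n, ∃ hn : u n ≠ 0, Projectivization.mk ℝ (u n) hn ∈ S)
    (hlim : Filter.Tendsto u Filter.atTop (nhds v)) : Projectivization.mk ℝ v hv ∈ S := by
  choose hn hmem using hu
  have h : Filter.Tendsto (fun n ↦ (⟨u n, hn n⟩ : {v : Fin 2 → ℝ // v ≠ 0})) Filter.atTop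
      (nhds ⟨v, hv⟩) := tendsto_subtype_rng.2 hlim
  exact hS.mem_of_tendsto ((continuous_projectivization_mk.tendsto _).comp h)
    (Filter.Eventually.of_forall hmem)

theorem IsHyperbolic.conj {g : SL(2, ℝ)} (hg : _root_.IsHyperbolic g) (h : SL(2, ℝ)) :
    _root_.IsHyperbolic (h * g * h⁻¹) := by
  have : (h * g * h⁻¹).1.trace = g.1.trace := by
    rw [Matrix.SpecialLinearGroup.coe_mul, Matrix.trace_mul_comm,
      ← Matrix.SpecialLinearGroup.coe_mul, ← mul_assoc, inv_mul_cancel, one_mul]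
  unfold _root_.IsHyperbolic at hg ⊢
  rwa [this]

theorem isClosed_limitSet (H : Subgroup SL(2, ℝ)) : IsClosed (limitSet H) := isClosed_closure

theorem limitSet_mono {H K : Subgroup SL(2, ℝ)} (h : H ≤ K) : limitSet H ⊆ limitSet K :=
  closure_mono fun _ ⟨g, hg, hyp, hfix⟩ ↦ ⟨g, h hg, hyp, hfix⟩

theorem sl2Act_mem_limitSet {H : Subgroup SL(2, ℝ)} {h : SL(2, ℝ)} (hh : h ∈ H) {p : RP1}
    (hp : p ∈ limitSet H) : sl2Act h p ∈ limitSet H := by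
  refine map_mem_closure (continuous_sl2Act h) hp ?_
  rintro q ⟨g, hg, hyp, hfix⟩
  refine ⟨h * g * h⁻¹, H.mul_mem (H.mul_mem hh hg) (H.inv_mem hh), hyp.conj h, ?_⟩
  rw [← sl2Act_mul, inv_mul_cancel_right, sl2Act_mul, hfix]

theorem mk_mem_limitSet_of_eigenvector {H : Subgroup SL(2, ℝ)} {g : SL(2, ℝ)} (hg : g ∈ H)
    (hyp : _root_.IsHyperbolic g) {e : Fin 2 → ℝ} (he : e ≠ 0) {a : ℝ} (hge : g.1 *ᵥ e = a • e) :
    Projectivization.mk ℝ e he ∈ limitSet H := by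
  refine subset_closure ⟨g, hg, hyp, ?_⟩
  rw [sl2Act_mk]
  simp only [hge]
  exact mk_smul_eq he _

theorem mk_mulVec_mem_limitSet {H : Subgroup SL(2, ℝ)} {h : SL(2, ℝ)} (hh : h ∈ H)
    {v : Fin 2 → ℝ} (hv : v ≠ 0) (hp : Projectivization.mk ℝ v hv ∈ limitSet H) :
    Projectivization.mk ℝ (h.1 *ᵥ v) (mulVec_ne_zero h hv) ∈ limitSet H := by
  rw [← sl2Act_mk h hv]
  exact sl2Act_mem_limitSet hh hp

/-- Twice the hyperbolic cosine of the distance from `I` to `z`. -/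
def twoCoshDist (z : ℍ) : ℝ := (z.re ^ 2 + z.im ^ 2 + 1) / z.im

theorem continuous_twoCoshDist : Continuous twoCoshDist :=
  Continuous.div (by fun_prop) UpperHalfPlane.continuous_im fun z ↦ z.im_ne_zero

theorem twoCoshDist_smul (g : SL(2, ℝ)) (z : ℍ) :
    twoCoshDist (g • z) = (sqNorm (g.1 *ᵥ ![z.re, 1]) + z.im ^ 2 * sqNorm (g.1 *ᵥ ![1, 0])) /
      z.im := by
  have hz := z.im_pos
  set n : ℂ := (g 0 0 : ℂ) * z + (g 0 1 : ℂ) with hn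
  set d : ℂ := (g 1 0 : ℂ) * z + (g 1 1 : ℂ) with hd
  have hcoe : ((g • z : ℍ) : ℂ) = n / d := by
    rw [UpperHalfPlane.coe_specialLinearGroup_apply]; rfl
  have hN : Complex.normSq n = (g 0 0 * z.re + g 0 1) ^ 2 + (g 0 0 * z.im) ^ 2 := by
    simp [hn, Complex.normSq_apply]; ring
  have hD : Complex.normSq d = (g 1 0 * z.re + g 1 1) ^ 2 + (g 1 0 * z.im) ^ 2 := by
    simp [hd, Complex.normSq_apply]; ring
  have him : (g • z : ℍ).im = z.im / Complex.normSq d := by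
    have hdet := g.2
    rw [Matrix.det_fin_two] at hdet
    rw [← UpperHalfPlane.coe_im, hcoe, Complex.div_im]
    rw [← sub_div]
    congr 1
    simp only [hn, hd, Complex.add_im, Complex.mul_im, Complex.add_re, Complex.mul_re,
      Complex.ofReal_re, Complex.ofReal_im, UpperHalfPlane.coe_re, UpperHalfPlane.coe_im]
    linear_combination z.im * hdet
  have hsq : (g • z : ℍ).re ^ 2 + (g • z : ℍ).im ^ 2 = Complex.normSq n / Complex.normSq d := by
    rw [← Complex.normSq_div, ← hcoe, Complex.normSq_apply]
    simp; ring
  have hD0 : Complex.normSq d ≠ 0 := by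
    intro h
    have := (g • z : ℍ).im_pos
    rw [him, h] at this
    simp at this
  rw [twoCoshDist, hsq, him]
  have : sqNorm (g.1 *ᵥ ![z.re, 1]) + z.im ^ 2 * sqNorm (g.1 *ᵥ ![1, 0]) =
      Complex.normSq n + Complex.normSq d := by
    rw [hN, hD]
    simp only [sqNorm, mulVec_zero_apply, mulVec_one_apply]
    simp
    ring
  rw [this]
  field_simp

/-- The geodesic ray `ray [v]` in terms of the energy. -/
theorem exists_basis_ray {v : Fin 2 → ℝ} (hv : v ≠ 0) :
    ∃ v₀ w₀ : Fin 2 → ℝ, cross v₀ w₀ ≠ 0 ∧ (∃ c : ℝ, v = c • v₀) ∧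
      ∀ z ∈ ray (Projectivization.mk ℝ v hv), ∃ s, 1 ≤ s ∧
        ∀ g : SL(2, ℝ), twoCoshDist (g • z) = energy v₀ w₀ s g := by
  obtain ⟨a, ha⟩ := Projectivization.exists_smul_eq_mk_rep ℝ v hv
  set u := (Projectivization.mk ℝ v hv).rep with hu
  have hvu : v = (a⁻¹ : ℝˣ) • u := by rw [← ha, inv_smul_smul]
  have hvu' : v = ((a⁻¹ : ℝˣ) : ℝ) • u := hvu
  by_cases h1 : u 1 = 0
  · have hu0 : u = u 0 • ![1, 0] := by
      ext i
      fin_cases i <;> simp [h1]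
    refine ⟨![1, 0], ![0, 1], by simp [cross], ⟨((a⁻¹ : ℝˣ) : ℝ) * u 0, ?_⟩, ?_⟩
    · rw [mul_smul, ← hu0, hvu']
    · intro z hz
      rw [ray, ← hu, if_pos h1] at hz
      refine ⟨z.im, hz.2, fun g ↦ ?_⟩
      have hz0 := z.im_pos
      rw [twoCoshDist_smul, hz.1, energy]
      field_simp
      ring
  · have hu0 : u = u 1 • ![u 0 / u 1, 1] := by
      ext i
      fin_cases i
      · simp; field_simp
      · simp
    refine ⟨![u 0 / u 1, 1], ![1, 0], by simp [cross], ⟨((a⁻¹ : ℝˣ) : ℝ) * u 1, ?_⟩, ?_⟩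
    · rw [mul_smul, ← hu0, hvu']
    · intro z hz
      rw [ray, ← hu, if_neg h1] at hz
      have hz0 := z.im_pos
      refine ⟨z.im⁻¹, (one_le_inv₀ hz0).2 hz.2, fun g ↦ ?_⟩
      rw [twoCoshDist_smul, hz.1, energy]
      field_simp

theorem energy_change_basis_le {v₀ w₀ : Fin 2 → ℝ} (a b c : ℝ) {s : ℝ} (hs : 1 ≤ s)
    (g : SL(2, ℝ)) :
    energy (c • v₀) (a • v₀ + b • w₀) s g ≤
      (c ^ 2 + 2 * a ^ 2 + 2 * b ^ 2) * energy v₀ w₀ s g := by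
  have hs0 : 0 < s := by linarith
  have hA := sqNorm_nonneg (g.1 *ᵥ v₀)
  have hB := sqNorm_nonneg (g.1 *ᵥ w₀)
  simp only [energy, Matrix.mulVec_smul, Matrix.mulVec_add, sqNorm_smul]
  have h := sqNorm_add_le (a • g.1 *ᵥ v₀) (b • g.1 *ᵥ w₀)
  rw [sqNorm_smul, sqNorm_smul] at h
  generalize sqNorm (g.1 *ᵥ v₀) = A at *
  generalize sqNorm (g.1 *ᵥ w₀) = B at *
  have hs1 : s⁻¹ ≤ s := (inv_le_one_of_one_le₀ hs).trans hs
  have hs2 : 0 < s⁻¹ := inv_pos.2 hs0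
  have h1 := mul_le_mul_of_nonneg_left h hs2.le
  have h2 : s⁻¹ * (a ^ 2 * A) ≤ s * (a ^ 2 * A) := by gcongr
  have h3 : 0 ≤ s * (b ^ 2 * A) := by positivity
  have h4 : 0 ≤ s⁻¹ * (a ^ 2 * B) := by positivity
  have h5 : 0 ≤ s⁻¹ * (c ^ 2 * B) := by positivity
  linarith

/-- The set of elements of `H` that move some point of the ray with basis `v`, `w` to a bounded
distance of the base point. -/
def nearRay (H : Subgroup SL(2, ℝ)) (v w : Fin 2 → ℝ) (C : ℝ) : Set SL(2, ℝ) :=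
  {g | g ∈ H ∧ ∃ s, 1 ≤ s ∧ energy v w s g ≤ C}

theorem IsConicalLimitPoint.exists_infinite_nearRay {H : Subgroup SL(2, ℝ)} {v : Fin 2 → ℝ}
    {hv : v ≠ 0} (h : IsConicalLimitPoint H (Projectivization.mk ℝ v hv)) (w : Fin 2 → ℝ) :
    ∃ C, (nearRay H v w C).Infinite := by
  obtain ⟨K, hK, γ, hinj, hγ, hne⟩ := h
  obtain ⟨v₀, w₀, hcross, ⟨c, hc⟩, hray⟩ := exists_basis_ray hv
  obtain ⟨C, hC⟩ := (hK.image continuous_twoCoshDist).bddAbove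
  obtain ⟨a, b, hw⟩ : ∃ a b : ℝ, w = a • v₀ + b • w₀ := ⟨_, _, eq_smul_add_smul hcross w⟩
  refine ⟨(c ^ 2 + 2 * a ^ 2 + 2 * b ^ 2) * C, Set.infinite_of_injective_forall_mem
    (f := fun k ↦ (γ k)⁻¹) (inv_injective.comp hinj) fun k ↦ ⟨H.inv_mem (hγ k), ?_⟩⟩
  obtain ⟨z, hz, hzr⟩ := hne k
  obtain ⟨s, hs, hE⟩ := hray z hzr
  refine ⟨s, hs, ?_⟩
  rw [hc, hw]
  refine (energy_change_basis_le a b c hs _).trans ?_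
  have : energy v₀ w₀ s (γ k)⁻¹ ≤ C := by
    rw [← hE]
    exact hC ⟨_, Set.mem_smul_set_iff_inv_smul_mem.1 hz, rfl⟩
  gcongr

theorem exists_mem_nearRay_of_infinite {Γ H : Subgroup SL(2, ℝ)} (hΓ : DiscreteTopology Γ)
    (hH : H ≤ Γ) {v w : Fin 2 → ℝ} (hvw : cross v w ≠ 0) {C : ℝ}
    (hinf : (nearRay H v w C).Infinite) (M : ℝ) :
    ∃ g ∈ H, ∃ s, M ≤ s ∧ 1 ≤ s ∧ energy v w s g ≤ C := by
  by_contra! hcon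
  refine hinf ((finite_hsNorm_le hΓ
    ((C + M * C) * (sqNorm v + sqNorm w) / cross v w ^ 2)).subset ?_)
  rintro g ⟨hg, s, hs, hE⟩
  refine ⟨hH hg, ?_⟩
  have hsM : s < M := lt_of_not_ge fun h ↦ (hcon g hg s h hs).not_ge hE
  have hs0 : 0 < s := by linarith
  have hD : 0 < cross v w ^ 2 := by positivity
  rw [le_div_iff₀ hD, mul_comm]
  refine (hsNorm_le_of_sqNorm_le v w g).trans ?_
  have hC : 0 ≤ C := (energy_nonneg v w hs0 g).trans hE
  have hA := sqNorm_nonneg (g.1 *ᵥ v)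
  have hB := sqNorm_nonneg (g.1 *ᵥ w)
  have hB' : 0 ≤ s⁻¹ * sqNorm (g.1 *ᵥ w) := by positivity
  have hV := sqNorm_nonneg v
  have hW := sqNorm_nonneg w
  unfold energy at hE
  have h1 : sqNorm (g.1 *ᵥ v) ≤ C := by nlinarith
  have h2 : sqNorm (g.1 *ᵥ w) ≤ s * C := by
    rw [← inv_mul_le_iff₀ hs0]
    nlinarith
  have h3 : sqNorm (g.1 *ᵥ w) ≤ M * C := h2.trans (by gcongr)
  gcongr

/-- Conical limit points are horospherical: the orbit of a vector representing such a point
accumulates at the origin. -/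
theorem exists_sqNorm_mulVec_lt_of_infinite {Γ H : Subgroup SL(2, ℝ)} (hΓ : DiscreteTopology Γ)
    (hH : H ≤ Γ) {v w : Fin 2 → ℝ} (hvw : cross v w ≠ 0) {C : ℝ}
    (hinf : (nearRay H v w C).Infinite) {ε : ℝ} (hε : 0 < ε) :
    ∃ g ∈ H, sqNorm (g.1 *ᵥ v) < ε := by
  obtain ⟨g, hg, s, hs, hs1, hE⟩ := exists_mem_nearRay_of_infinite hΓ hH hvw hinf (C / ε + 1)
  refine ⟨g, hg, ?_⟩
  have hs0 : 0 < s := by linarith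
  have hB : 0 ≤ s⁻¹ * sqNorm (g.1 *ᵥ w) := mul_nonneg (inv_pos.2 hs0).le (sqNorm_nonneg _)
  have h1 : C < ε * s := by
    rw [mul_comm, ← div_lt_iff₀ hε]
    linarith
  unfold energy at hE
  by_contra! h
  nlinarith

theorem exists_cross_ne_zero {v : Fin 2 → ℝ} (hv : v ≠ 0) : ∃ w, cross v w ≠ 0 := by
  refine ⟨![-v 1, v 0], ?_⟩
  have : cross v ![-v 1, v 0] = sqNorm v := by simp [cross, sqNorm]; ring
  rw [this]
  exact (sqNorm_pos hv).ne'

theorem exists_smul_eq_of_cross_eq_zero {v w : Fin 2 → ℝ} (hv : v ≠ 0) (h : cross v w = 0) :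
    ∃ t : ℝ, w = t • v := by
  obtain ⟨u, hu⟩ := exists_cross_ne_zero hv
  exact ⟨_, by simpa [h] using eq_smul_add_smul hu w⟩

/-- In a discrete group with only conical limit points, the orbit of a vector representing a limit
point accumulates at the origin. -/
theorem ConvexCocompact.exists_sqNorm_mulVec_lt {Γ H : Subgroup SL(2, ℝ)}
    (hΓ : DiscreteTopology Γ) (hH : H ≤ Γ) (hcc : ConvexCocompact H) {v : Fin 2 → ℝ} (hv : v ≠ 0)
    (hmem : Projectivization.mk ℝ v hv ∈ limitSet H) {ε : ℝ} (hε : 0 < ε) :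
    ∃ g ∈ H, sqNorm (g.1 *ᵥ v) < ε := by
  obtain ⟨w, hw⟩ := exists_cross_ne_zero hv
  rw [hcc] at hmem
  obtain ⟨C, hC⟩ := hmem.exists_infinite_nearRay w
  exact exists_sqNorm_mulVec_lt_of_infinite hΓ hH hw hC hε

/-- If the pair `x`, `y` degenerates but its orbit stays away from `0`, then `x` cannot represent a
limit point of a group all of whose limit points are conical. -/
theorem ConvexCocompact.eq_zero_of_cross_eq_zero {Γ H : Subgroup SL(2, ℝ)}
    (hΓ : DiscreteTopology Γ) (hH : H ≤ Γ) (hcc : ConvexCocompact H) {x y : Fin 2 → ℝ}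
    (hxy : cross x y = 0) {δ : ℝ} (hδ : 0 < δ)
    (hlow : ∀ g ∈ H, δ ≤ sqNorm (g.1 *ᵥ x) + sqNorm (g.1 *ᵥ y))
    (hmem : ∀ hx : x ≠ 0, Projectivization.mk ℝ x hx ∈ limitSet H) : x = 0 := by
  by_contra hx
  obtain ⟨t, rfl⟩ := exists_smul_eq_of_cross_eq_zero hx hxy
  obtain ⟨g, hg, hlt⟩ := hcc.exists_sqNorm_mulVec_lt hΓ hH hx (hmem hx)
    (div_pos hδ (by positivity : 0 < 1 + t ^ 2))
  have := hlow g hg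
  rw [Matrix.mulVec_smul, sqNorm_smul] at this
  rw [lt_div_iff₀ (by positivity)] at hlt
  linarith

theorem isCompact_sqNorm_le_one : IsCompact {v : Fin 2 → ℝ | sqNorm v ≤ 1} := by
  refine (isCompact_univ_pi fun _ ↦ isCompact_Icc (a := (-1 : ℝ)) (b := 1)).of_isClosed_subset
    (isClosed_le continuous_sqNorm continuous_const) fun v hv i _ ↦ ?_
  have h : sqNorm v ≤ 1 := hv
  unfold sqNorm at h
  rw [Set.mem_Icc, ← abs_le, ← sq_le_one_iff_abs_le_one]
  fin_cases i
  · show v 0 ^ 2 ≤ 1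
    nlinarith [sq_nonneg (v 1)]
  · show v 1 ^ 2 ≤ 1
    nlinarith [sq_nonneg (v 0)]

theorem exists_energy_le_two_mul {H : Subgroup SL(2, ℝ)} {v w : Fin 2 → ℝ} {s m : ℝ} (hm : 0 < m)
    (hlow : ∀ g ∈ H, m ≤ energy v w s g) :
    ∃ g ∈ H, ∀ h ∈ H, energy v w s g ≤ 2 * energy v w s h := by
  have hne : (energy v w s '' H).Nonempty := ⟨_, 1, H.one_mem, rfl⟩
  have hbdd : BddBelow (energy v w s '' H) := ⟨m, by rintro _ ⟨g, hg, rfl⟩; exact hlow g hg⟩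
  have hI : m ≤ sInf (energy v w s '' H) :=
    le_csInf hne (by rintro _ ⟨g, hg, rfl⟩; exact hlow g hg)
  obtain ⟨_, ⟨g, hg, rfl⟩, hlt⟩ := exists_lt_of_csInf_lt hne
    (by linarith : sInf (energy v w s '' H) < 2 * sInf (energy v w s '' H))
  refine ⟨g, hg, fun h hh ↦ ?_⟩
  have := csInf_le hbdd ⟨h, hh, rfl⟩
  linarith

/-- If all limit points of `H` are conical, then `H` acts cocompactly on the union of the geodesics
with endpoints in the limit set; here for a single geodesic. -/
theorem ConvexCocompact.exists_energy_le {Γ H : Subgroup SL(2, ℝ)} (hΓ : DiscreteTopology Γ)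
    (hH : H ≤ Γ) (hcc : ConvexCocompact H) {v w : Fin 2 → ℝ} (hv : v ≠ 0) (hw : w ≠ 0)
    (hvmem : Projectivization.mk ℝ v hv ∈ limitSet H)
    (hwmem : Projectivization.mk ℝ w hw ∈ limitSet H) :
    ∃ C, ∀ s, 0 < s → ∃ g ∈ H, energy v w s g ≤ C := by
  by_contra! hcon
  choose s hs hlow using fun n : ℕ ↦ hcon (n + 1)
  choose φ hφ hmin using fun n : ℕ ↦
    exists_energy_le_two_mul (by positivity : (0 : ℝ) < n + 1) fun g hg ↦ (hlow n g hg).le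
  set Q : ℕ → ℝ := fun n ↦ energy v w (s n) (φ n) with hQ
  have hQn (n : ℕ) : (n : ℝ) + 1 < Q n := hlow n _ (hφ n)
  have hQ0 (n : ℕ) : 0 < Q n := lt_trans (by positivity) (hQn n)
  set a : ℕ → ℝ := fun n ↦ √(s n / Q n) with ha
  set b : ℕ → ℝ := fun n ↦ √((s n)⁻¹ / Q n) with hb
  have ha2 (n : ℕ) : a n ^ 2 = s n / Q n := Real.sq_sqrt (div_pos (hs n) (hQ0 n)).le
  have hb2 (n : ℕ) : b n ^ 2 = (s n)⁻¹ / Q n :=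
    Real.sq_sqrt (div_pos (inv_pos.2 (hs n)) (hQ0 n)).le
  have ha0 (n : ℕ) : a n ≠ 0 := (Real.sqrt_pos.2 (div_pos (hs n) (hQ0 n))).ne'
  have hb0 (n : ℕ) : b n ≠ 0 := (Real.sqrt_pos.2 (div_pos (inv_pos.2 (hs n)) (hQ0 n))).ne'
  set x : ℕ → Fin 2 → ℝ := fun n ↦ a n • ((φ n).1 *ᵥ v) with hx
  set y : ℕ → Fin 2 → ℝ := fun n ↦ b n • ((φ n).1 *ᵥ w) with hy
  have hxy (g : SL(2, ℝ)) (n : ℕ) : sqNorm (g.1 *ᵥ x n) + sqNorm (g.1 *ᵥ y n) =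
      energy v w (s n) (g * φ n) / Q n := by
    simp only [hx, hy, Matrix.mulVec_smul, sqNorm_smul, ha2, hb2, energy, mul_mulVec]
    ring
  have hxy1 (n : ℕ) : sqNorm (x n) + sqNorm (y n) = 1 := by
    have := hxy 1 n
    rw [one_mul, div_self (hQ0 n).ne'] at this
    simpa using this
  have hcross (n : ℕ) : cross (x n) (y n) ^ 2 ≤ cross v w ^ 2 * (1 / ((n : ℝ) + 1)) := by
    have h1 : cross (x n) (y n) ^ 2 = cross v w ^ 2 * (1 / (Q n * Q n)) := by
      have := (hs n).ne'
      simp only [hx, hy]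
      rw [cross_smul_smul, cross_mulVec, mul_pow, mul_pow, ha2, hb2]
      field_simp
    rw [h1]
    have h2 := hQn n
    have h3 : (0 : ℝ) ≤ n := n.cast_nonneg
    gcongr
    nlinarith
  have hxmem (n : ℕ) : ∃ h : x n ≠ 0, Projectivization.mk ℝ (x n) h ∈ limitSet H := by
    refine ⟨smul_ne_zero (ha0 n) (mulVec_ne_zero _ hv), ?_⟩
    rw [mk_smul_eq (mulVec_ne_zero _ hv)]
    exact mk_mulVec_mem_limitSet (hφ n) hv hvmem
  have hymem (n : ℕ) : ∃ h : y n ≠ 0, Projectivization.mk ℝ (y n) h ∈ limitSet H := by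
    refine ⟨smul_ne_zero (hb0 n) (mulVec_ne_zero _ hw), ?_⟩
    rw [mk_smul_eq (mulVec_ne_zero _ hw)]
    exact mk_mulVec_mem_limitSet (hφ n) hw hwmem
  obtain ⟨⟨α, β⟩, -, ψ, hψ, hlim⟩ := (isCompact_sqNorm_le_one.prod
    isCompact_sqNorm_le_one).tendsto_subseq (x := fun n ↦ (x n, y n)) fun n ↦
      ⟨by have := hxy1 n; have := sqNorm_nonneg (y n); show sqNorm (x n) ≤ 1; linarith,
       by have := hxy1 n; have := sqNorm_nonneg (x n); show sqNorm (y n) ≤ 1; linarith⟩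
  have hα : Filter.Tendsto (x ∘ ψ) Filter.atTop (nhds α) :=
    (continuous_fst.tendsto _).comp hlim
  have hβ : Filter.Tendsto (y ∘ ψ) Filter.atTop (nhds β) :=
    (continuous_snd.tendsto _).comp hlim
  have hαβ : cross α β = 0 := by
    have hc : Continuous fun p : (Fin 2 → ℝ) × (Fin 2 → ℝ) ↦ cross p.1 p.2 ^ 2 := by
      unfold cross; fun_prop
    have h1 := (hc.tendsto (α, β)).comp hlim
    have h2 : Filter.Tendsto (fun n : ℕ ↦ cross v w ^ 2 * (1 / ((n : ℝ) + 1))) Filter.atTop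
        (nhds 0) := by
      simpa using tendsto_one_div_add_atTop_nhds_zero_nat.const_mul (cross v w ^ 2)
    have h3 := le_of_tendsto_of_tendsto' h1 (h2.comp hψ.tendsto_atTop) fun n ↦ hcross (ψ n)
    exact pow_eq_zero_iff two_ne_zero |>.1 (le_antisymm h3 (sq_nonneg _))
  have hlow' : ∀ g ∈ H, 1 / 2 ≤ sqNorm (g.1 *ᵥ α) + sqNorm (g.1 *ᵥ β) := by
    intro g hg
    have hc : Continuous fun p : (Fin 2 → ℝ) × (Fin 2 → ℝ) ↦
        sqNorm (g.1 *ᵥ p.1) + sqNorm (g.1 *ᵥ p.2) := by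
      unfold sqNorm; fun_prop
    refine ge_of_tendsto' ((hc.tendsto (α, β)).comp hlim) fun n ↦ ?_
    show 1 / 2 ≤ sqNorm (g.1 *ᵥ x (ψ n)) + sqNorm (g.1 *ᵥ y (ψ n))
    rw [hxy, le_div_iff₀ (hQ0 _)]
    have := hmin (ψ n) _ (H.mul_mem hg (hφ (ψ n)))
    simp only [hQ]
    linarith
  have hα0 : α = 0 := hcc.eq_zero_of_cross_eq_zero hΓ hH hαβ one_half_pos hlow'
    fun h ↦ (isClosed_limitSet H).mk_mem_of_tendsto h (fun n ↦ hxmem (ψ n)) hα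
  have hβ0 : β = 0 := hcc.eq_zero_of_cross_eq_zero hΓ hH (y := α)
    (by simp only [cross] at hαβ ⊢; linarith) one_half_pos
    (fun g hg ↦ by rw [add_comm]; exact hlow' g hg)
    fun h ↦ (isClosed_limitSet H).mk_mem_of_tendsto h (fun n ↦ hymem (ψ n)) hβ
  have := hlow' 1 H.one_mem
  rw [hα0, hβ0] at this
  simp [sqNorm] at this
  linarith

/-- If the ray towards `[v]` stays close to the orbit of `Φ` and returns infinitely often close to
the orbit of `Θ`, then it returns infinitely often close to the orbit of `Φ ⊓ Θ`. -/
theorem exists_infinite_nearRay_inf {Γ Φ Θ : Subgroup SL(2, ℝ)} (hΓ : DiscreteTopology Γ)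
    (hΦ : Φ ≤ Γ) (hΘ : Θ ≤ Γ) {v w : Fin 2 → ℝ} (hvw : cross v w ≠ 0) {C D : ℝ}
    (hC : ∀ s, 0 < s → ∃ g ∈ Φ, energy v w s g ≤ C) (hD : (nearRay Θ v w D).Infinite) :
    ∃ E, (nearRay (Φ ⊓ Θ) v w E).Infinite := by
  set T : SL(2, ℝ) → Set SL(2, ℝ) := fun k ↦ {θ | θ ∈ nearRay Θ v w D ∧ ∃ φ ∈ Φ, θ = k * φ}
    with hT
  obtain ⟨k, hk⟩ : ∃ k, (T k).Infinite := by
    by_contra! hfin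
    refine hD (((finite_hsNorm_le hΓ (D * C / cross v w ^ 2)).biUnion
      fun k _ ↦ hfin k).subset ?_)
    rintro θ ⟨hθ, s, hs, hE⟩
    have hs0 : 0 < s := by linarith
    obtain ⟨φ, hφ, hφE⟩ := hC s hs0
    refine Set.mem_biUnion (x := θ * φ⁻¹)
      ⟨Γ.mul_mem (hΘ hθ) (Γ.inv_mem (hΦ hφ)), ?_⟩ ⟨⟨hθ, s, hs, hE⟩, φ, hφ, by group⟩
    rw [le_div_iff₀ (by positivity), mul_comm]
    refine (cross_sq_mul_hsNorm_le v w hs0 θ φ).trans ?_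
    exact mul_le_mul hE hφE (energy_nonneg v w hs0 φ) ((energy_nonneg v w hs0 θ).trans hE)
  obtain ⟨θ₀, ⟨hθ₀, -⟩, φ₀, hφ₀, h₀⟩ := hk.nonempty
  refine ⟨hsNorm θ₀⁻¹ * D, (hk.image (f := (θ₀⁻¹ * ·)) (mul_right_injective _).injOn).mono ?_⟩
  rintro _ ⟨θ, ⟨⟨hθ, s, hs, hE⟩, φ, hφ, rfl⟩, rfl⟩
  refine ⟨⟨?_, Θ.mul_mem (Θ.inv_mem hθ₀) hθ⟩, s, hs, ?_⟩
  · have : θ₀⁻¹ * (k * φ) = φ₀⁻¹ * φ := by rw [h₀]; group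
    simp only [this]
    exact Φ.mul_mem (Φ.inv_mem hφ₀) hφ
  · refine (energy_mul_le v w (by linarith) _ _).trans ?_
    exact mul_le_mul_of_nonneg_left hE (hsNorm_nonneg _)

theorem IsClosed.exists_pos_of_mk_notMem {S : Set RP1} (hS : IsClosed S) {v : Fin 2 → ℝ}
    {hv : v ≠ 0} (h : Projectivization.mk ℝ v hv ∉ S) (w : Fin 2 → ℝ) :
    ∃ ε > 0, ∀ x y : ℝ, ∀ hne : x • v + y • w ≠ 0,
      Projectivization.mk ℝ (x • v + y • w) hne ∈ S → ε * x ^ 2 ≤ y ^ 2 := by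
  by_contra! hcon
  choose x y hne hmem hlt using fun n : ℕ ↦ hcon (1 / ((n : ℝ) + 1)) (by positivity)
  have hx0 (n : ℕ) : x n ≠ 0 := by
    intro hx
    have := hlt n
    rw [hx] at this
    nlinarith [sq_nonneg (y n)]
  have hr : Filter.Tendsto (fun n ↦ y n / x n) Filter.atTop (nhds 0) := by
    have h2 : Filter.Tendsto (fun n ↦ (y n / x n) ^ 2) Filter.atTop (nhds 0) := by
      refine squeeze_zero (fun n ↦ sq_nonneg _) (fun n ↦ ?_)
        tendsto_one_div_add_atTop_nhds_zero_nat
      have := hx0 n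
      rw [div_pow, div_le_iff₀ (by positivity)]
      exact (hlt n).le
    have h3 := h2.sqrt
    simp only [Real.sqrt_sq_eq_abs, Real.sqrt_zero] at h3
    exact (tendsto_zero_iff_abs_tendsto_zero _).2 h3
  refine h (hS.mk_mem_of_tendsto (u := fun n ↦ v + (y n / x n) • w) hv (fun n ↦ ?_) ?_)
  · have he : v + (y n / x n) • w = (x n)⁻¹ • (x n • v + y n • w) := by
      rw [smul_add, smul_smul, smul_smul, inv_mul_cancel₀ (hx0 n), one_smul, div_eq_inv_mul]
    simp only [he]
    refine ⟨smul_ne_zero (inv_ne_zero (hx0 n)) (hne n), ?_⟩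
    rw [mk_smul_eq (hne n)]
    exact hmem n
  · simpa using (hr.smul_const w).const_add v

/-- A point to which the orbit of a discrete purely hyperbolic group converges conically belongs to
its limit set. -/
theorem mk_mem_limitSet_of_infinite_nearRay {Γ H : Subgroup SL(2, ℝ)} (hΓ : DiscreteTopology Γ)
    (hPH : PurelyHyperbolic Γ) (hH : H ≤ Γ) {v w : Fin 2 → ℝ} (hvw : cross v w ≠ 0) (hv : v ≠ 0)
    {C : ℝ} (hinf : (nearRay H v w C).Infinite) : Projectivization.mk ℝ v hv ∈ limitSet H := by
  by_contra hnot
  obtain ⟨ε, hε, hε'⟩ := (isClosed_limitSet H).exists_pos_of_mk_notMem hnot w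
  obtain ⟨g, ⟨hg, -⟩, hg1⟩ := hinf.exists_notMem_finite (Set.finite_singleton 1)
  have hyp := hPH g (hH hg) hg1
  obtain ⟨e, f, a, b, hef, he, hf⟩ := hyp.exists_eigenvectors
  have hratio (h : SL(2, ℝ)) (hh : h ∈ H) (u : Fin 2 → ℝ) (hu : u ≠ 0)
      (humem : Projectivization.mk ℝ u hu ∈ limitSet H) :
      ε * cross u (h.1 *ᵥ w) ^ 2 ≤ cross (h.1 *ᵥ v) u ^ 2 := by
    have h1 : cross u (h.1 *ᵥ w) • v + cross (h.1 *ᵥ v) u • w =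
        cross v w • (h⁻¹.1 *ᵥ u) := by
      have := congrArg (h⁻¹.1 *ᵥ ·) (cross_smul_eq (h.1 *ᵥ v) (h.1 *ᵥ w) u)
      simp only [cross_mulVec, Matrix.mulVec_add, Matrix.mulVec_smul, ← mul_mulVec,
        inv_mul_cancel] at this
      simpa using this.symm
    have hu' := mulVec_ne_zero h⁻¹ hu
    refine hε' _ _ (h1 ▸ smul_ne_zero hvw hu') ?_
    simp only [h1]
    rw [mk_smul_eq hu']
    exact mk_mulVec_mem_limitSet (H.inv_mem hh) hu humem
  have hpos : 0 < ε * (cross v w * cross e f) ^ 2 := by positivity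
  obtain ⟨h, hh, s, hs, hs1, hE⟩ := exists_mem_nearRay_of_infinite hΓ hH hvw hinf
    (4 * C ^ 2 * sqNorm e * sqNorm f / (ε * (cross v w * cross e f) ^ 2) + 1)
  have he0 := ne_zero_of_cross_ne_zero_left hef
  have hf0 := ne_zero_of_cross_ne_zero_right hef
  have hXe := hratio h hh e he0 (mk_mem_limitSet_of_eigenvector hg hyp he0 he)
  have hXf := hratio h hh f hf0 (mk_mem_limitSet_of_eigenvector hg hyp hf0 hf)
  have hYe := cross_sq_le (h.1 *ᵥ v) e
  have hYf := cross_sq_le (h.1 *ᵥ v) f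
  have hid : cross v w * cross e f = cross e (h.1 *ᵥ w) * cross (h.1 *ᵥ v) f -
      cross (h.1 *ᵥ v) e * cross f (h.1 *ᵥ w) := by
    rw [← cross_mulVec h v w]
    simp only [cross]; ring
  have hs0 : 0 < s := by linarith
  have hA : s * sqNorm (h.1 *ᵥ v) ≤ C := by
    have := mul_nonneg (inv_pos.2 hs0).le (sqNorm_nonneg (h.1 *ᵥ w))
    unfold energy at hE
    linarith
  have hA0 := sqNorm_nonneg (h.1 *ᵥ v)
  have he1 := sqNorm_nonneg e
  have hf1 := sqNorm_nonneg f
  have hlt : 4 * C ^ 2 * sqNorm e * sqNorm f < s * (ε * (cross v w * cross e f) ^ 2) := by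
    rw [← div_lt_iff₀ hpos]
    linarith
  rw [hid] at hlt
  generalize cross e (h.1 *ᵥ w) = X at *
  generalize cross f (h.1 *ᵥ w) = X' at *
  generalize cross (h.1 *ᵥ v) e = Y at *
  generalize cross (h.1 *ᵥ v) f = Y' at *
  generalize sqNorm (h.1 *ᵥ v) = A at *
  generalize sqNorm e = E at *
  generalize sqNorm f = F at *
  have h1 : (X * Y' - Y * X') ^ 2 ≤ 2 * (X ^ 2 * Y' ^ 2) + 2 * (X' ^ 2 * Y ^ 2) := by
    nlinarith [sq_nonneg (X * Y' + Y * X')]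
  have h2 : ε * X ^ 2 * Y' ^ 2 ≤ Y ^ 2 * Y' ^ 2 := by gcongr
  have h3 : ε * X' ^ 2 * Y ^ 2 ≤ Y' ^ 2 * Y ^ 2 := by gcongr
  have h4 : Y ^ 2 * Y' ^ 2 ≤ (A * E) * (A * F) := by gcongr
  have h5 : ε * (X * Y' - Y * X') ^ 2 ≤ 4 * ((A * E) * (A * F)) := by
    have := mul_le_mul_of_nonneg_left h1 hε.le
    linarith
  have h6 : A ≤ C := by nlinarith
  have h7 : s * A * A ≤ C * C := by gcongr; linarith
  have h8 : s * A * A * (E * F) ≤ C * C * (E * F) := by gcongr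
  have h9 := mul_le_mul_of_nonneg_left h5 hs0.le
  linarith

theorem exists_mem_limitSet_cross_ne_zero {H : Subgroup SL(2, ℝ)} {g : SL(2, ℝ)} (hg : g ∈ H)
    (hyp : _root_.IsHyperbolic g) {v : Fin 2 → ℝ} (hv : v ≠ 0) :
    ∃ w, cross v w ≠ 0 ∧ ∃ hw : w ≠ 0, Projectivization.mk ℝ w hw ∈ limitSet H := by
  obtain ⟨e, f, a, b, hef, he, hf⟩ := hyp.exists_eigenvectors
  have he0 := ne_zero_of_cross_ne_zero_left hef
  have hf0 := ne_zero_of_cross_ne_zero_right hef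
  by_cases hve : cross v e = 0
  · refine ⟨f, fun hvf ↦ ?_, hf0, mk_mem_limitSet_of_eigenvector hg hyp hf0 hf⟩
    have hev : cross e v = 0 := by simp only [cross] at hve ⊢; linarith
    have := cross_smul_eq e f v
    rw [hvf, hev, zero_smul, zero_smul, add_zero] at this
    exact smul_ne_zero hef hv this
  · exact ⟨e, hve, he0, mk_mem_limitSet_of_eigenvector hg hyp he0 he⟩

/-- **Susskind–Swarup (two-dimensional case).** Let `Γ` be a non-elementary discrete purely
hyperbolic subgroup of `SL(2, ℝ)` and let `Φ` and `Θ` be nontrivial convex cocompact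
subgroups of `Γ` with `Θ` non-elementary. Then `Λ(Φ) ∩ Λ(Θ) = Λ(Φ ∩ Θ)`. -/
theorem limitSet_inter_eq_of_convexCocompact
    (Γ : Subgroup SL(2, ℝ)) (hdisc : DiscreteTopology Γ)
    (hPH : PurelyHyperbolic Γ) (hNE : IsNonElementary Γ)
    (Φ Θ : Subgroup SL(2, ℝ)) (hΦΓ : Φ ≤ Γ) (hΘΓ : Θ ≤ Γ)
    (hΦnt : Φ ≠ ⊥) (hΘnt : Θ ≠ ⊥)
    (hΦcc : ConvexCocompact Φ) (hΘcc : ConvexCocompact Θ)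
    (hΘne : IsNonElementary Θ) :
    limitSet Φ ∩ limitSet Θ = limitSet (Φ ⊓ Θ) := by
  refine subset_antisymm ?_
    (Set.subset_inter (limitSet_mono inf_le_left) (limitSet_mono inf_le_right))
  rintro p ⟨hpΦ, hpΘ⟩
  induction p using Projectivization.ind with
  | h v hv =>
    obtain ⟨g, hg, hg1⟩ := Φ.bot_or_exists_ne_one.resolve_left hΦnt
    obtain ⟨w, hvw, hw, hwmem⟩ :=
      exists_mem_limitSet_cross_ne_zero hg (hPH _ (hΦΓ hg) hg1) hv
    obtain ⟨C, hC⟩ := hΦcc.exists_energy_le hdisc hΦΓ hv hw hpΦ hwmem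
    rw [hΘcc] at hpΘ
    obtain ⟨D, hD⟩ := IsConicalLimitPoint.exists_infinite_nearRay hpΘ w
    obtain ⟨E, hE⟩ := exists_infinite_nearRay_inf hdisc hΦΓ hΘΓ hvw hC hD
    exact mk_mem_limitSet_of_infinite_nearRay hdisc hPH (inf_le_left.trans hΦΓ) hvw hv hE

end
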